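/- Let a > 0 be a real number and n ≥ 1 a natural number. Then γ_{2n}(a) = (π·Γ(2a)·Γ(a+n) / (2^{2a-3} · Γ(2n+1) · Γ(a)^3)) · X_n(a), where γ_m(a) = ∫_{-1}^{1} ((C_m^{(a)}(x) - C_m^{(a)}(0))/x)^2 (1-x^2)^{a - 1/2} dx, C_m^{(a)} is the Gegenbauer polynomial, and X_n(a) = 2^{2n-1}·(a+1/2)_n - binom(2n-1, n-1)·(a)_n with (y)_n the Pochhammer symbol (rising factorial). -/

import Mathlib

open MeasureTheory Real

/-- The Gegenbauer polynomials `C_n^{(a)}`, defined by the recurrence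
`n C_n = 2x(n+a-1) C_{n-1} - (n+2a-2) C_{n-2}` with `C_0 = 1`, `C_1 = 2ax`. -/
noncomputable def gegenbauerC (a : ℝ) : ℕ → ℝ → ℝ
  | 0, _ => 1
  | 1, x => 2 * a * x
  | n + 2, x =>
      (2 * x * ((n : ℝ) + 1 + a) * gegenbauerC a (n + 1) x
        - ((n : ℝ) + 2 * a) * gegenbauerC a n x) / ((n : ℝ) + 2)

/-- `γ_n(a) = ∫_{-1}^1 ((C_n^{(a)}(x) - C_n^{(a)}(0))/x)^2 (1-x^2)^{a-1/2} dx`. -/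
noncomputable def gegenGamma (a : ℝ) (n : ℕ) : ℝ :=
  ∫ x in (-1 : ℝ)..1,
    ((gegenbauerC a n x - gegenbauerC a n 0) / x) ^ 2 * (1 - x ^ 2) ^ (a - 1 / 2)

/-- The Pochhammer symbol (rising factorial) `(y)_n = y (y+1) ⋯ (y+n-1)`. -/
noncomputable def poch (y : ℝ) (n : ℕ) : ℝ := ∏ k ∈ Finset.range n, (y + k)

/-- The polynomial `X_n(a) = 2^{2n-1} (a+1/2)_n - C(2n-1, n-1) (a)_n`. -/
noncomputable def Xpoly (n : ℕ) (a : ℝ) : ℝ :=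
  2 ^ (2 * n - 1) * poch (a + 1 / 2) n - (((2 * n - 1).choose (n - 1)) : ℝ) * poch a n

theorem poch_succ (y : ℝ) (n : ℕ) : poch y (n + 1) = poch y n * (y + n) :=
  Finset.prod_range_succ _ _

open Polynomial in
/-- The Gegenbauer polynomial `C_n^{(a)}` as an element of `ℝ[X]`. -/
noncomputable def gegenbauerPoly (a : ℝ) : ℕ → ℝ[X]
  | 0 => 1
  | 1 => C (2 * a) * X
  | n + 2 =>
      C ((n : ℝ) + 2)⁻¹ * (C (2 * ((n : ℝ) + 1 + a)) * (X * gegenbauerPoly a (n + 1))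
        - C ((n : ℝ) + 2 * a) * gegenbauerPoly a n)

theorem eval_gegenbauerPoly (a x : ℝ) :
    ∀ n, (gegenbauerPoly a n).eval x = gegenbauerC a n x
  | 0 => by simp [gegenbauerPoly, gegenbauerC]
  | 1 => by simp [gegenbauerPoly, gegenbauerC]
  | n + 2 => by
      simp only [gegenbauerPoly, gegenbauerC, Polynomial.eval_mul, Polynomial.eval_sub,
        Polynomial.eval_C, Polynomial.eval_X, eval_gegenbauerPoly a x (n + 1),
        eval_gegenbauerPoly a x n]
      ring

open Polynomial in
theorem gegenbauerPoly_recurrence (a : ℝ) (n : ℕ) :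
    C ((n : ℝ) + 2) * gegenbauerPoly a (n + 2)
      = C (2 * ((n : ℝ) + 1 + a)) * (X * gegenbauerPoly a (n + 1))
        - C ((n : ℝ) + 2 * a) * gegenbauerPoly a n := by
  rw [gegenbauerPoly, ← mul_assoc, ← C_mul, mul_inv_cancel₀ (by positivity), C_1, one_mul]

open Polynomial in
theorem X_mul_gegenbauerPoly (a : ℝ) (n : ℕ) :
    C (2 * ((n : ℝ) + 1 + a)) * (X * gegenbauerPoly a (n + 1))
      = C ((n : ℝ) + 2) * gegenbauerPoly a (n + 2)
        + C ((n : ℝ) + 2 * a) * gegenbauerPoly a n := by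
  rw [gegenbauerPoly_recurrence, sub_add_cancel]

open Polynomial in
theorem eval_derivative_gegenbauerPoly (a x : ℝ) (n : ℕ) :
    x * (derivative (gegenbauerPoly a (n + 1))).eval x
        - (derivative (gegenbauerPoly a n)).eval x
        = ((n : ℝ) + 1) * (gegenbauerPoly a (n + 1)).eval x ∧
      (derivative (gegenbauerPoly a (n + 1))).eval x
        - x * (derivative (gegenbauerPoly a n)).eval x
        = ((n : ℝ) + 2 * a) * (gegenbauerPoly a n).eval x := by
  induction n with
  | zero => constructor <;> simp [gegenbauerPoly, mul_comm]
  | succ n ih =>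
    obtain ⟨hA, hB⟩ := ih
    have hr := congrArg (eval x) (gegenbauerPoly_recurrence a n)
    have hd := congrArg (fun p => (derivative p).eval x) (gegenbauerPoly_recurrence a n)
    simp only [derivative_mul, derivative_sub, derivative_C, derivative_X, eval_mul, eval_sub,
      eval_add, eval_C, eval_X, zero_mul, zero_add, one_mul] at hr hd
    push_cast
    have hn : (n : ℝ) + 2 ≠ 0 := by positivity
    have hd' : (derivative (gegenbauerPoly a (n + 2))).eval x
        - x * (derivative (gegenbauerPoly a (n + 1))).eval x
        = ((n : ℝ) + 1 + 2 * a) * (gegenbauerPoly a (n + 1)).eval x := by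
      apply mul_left_cancel₀ hn
      linear_combination hd + ((n : ℝ) + 2 * a) * hA
    refine ⟨?_, hd'⟩
    linear_combination x * hd' - hr + x * hA - hB

open Polynomial in
theorem one_sub_X_sq_mul_derivative_gegenbauerPoly (a : ℝ) (n : ℕ) :
    (1 - X ^ 2) * derivative (gegenbauerPoly a (n + 1))
      = C ((n : ℝ) + 2 * a) * gegenbauerPoly a n
        - C ((n : ℝ) + 1) * (X * gegenbauerPoly a (n + 1)) := by
  apply Polynomial.funext
  intro x
  obtain ⟨hA, hB⟩ := eval_derivative_gegenbauerPoly a x n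
  simp only [eval_mul, eval_sub, eval_one, eval_pow, eval_C, eval_X]
  linear_combination hB - x * hA

theorem intervalIntegrable_one_sub_sq_rpow {s : ℝ} (hs : -1 < s) :
    IntervalIntegrable (fun x : ℝ => (1 - x ^ 2) ^ s) volume (-1) 1 := by
  have right : IntervalIntegrable (fun x : ℝ => (1 - x ^ 2) ^ s) volume 0 1 := by
    have h1 : IntervalIntegrable (fun x : ℝ => (1 - x) ^ s) volume 0 1 := by
      have := (intervalIntegral.intervalIntegrable_rpow' (a := 0) (b := 1) hs).comp_sub_left 1
      simpa using this.symm
    refine (h1.mul_continuousOn (g := fun x => (1 + x) ^ s) ?_).congr ?_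
    · refine ContinuousOn.rpow_const (by fun_prop) fun x hx => Or.inl ?_
      rw [Set.uIcc_of_le zero_le_one] at hx
      linarith [hx.1]
    · intro x hx
      rw [Set.uIoc_of_le zero_le_one] at hx
      simp only
      rw [← mul_rpow (by linarith [hx.2]) (by linarith [hx.1])]
      ring_nf
  have left := (right.comp_sub_left 0).symm
  simp only [zero_sub, sub_zero, neg_sq] at left
  exact left.trans right

open Polynomial in
theorem intervalIntegrable_eval_mul_weight {a : ℝ} (ha : 0 < a) (p : ℝ[X]) :
    IntervalIntegrable (fun x : ℝ => p.eval x * (1 - x ^ 2) ^ (a - 1 / 2)) volume (-1) 1 :=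
  (intervalIntegrable_one_sub_sq_rpow (by linarith)).continuousOn_mul p.continuous.continuousOn

open Polynomial in
/-- Integration against the Gegenbauer weight `(1 - x^2)^(a - 1/2)` on `[-1, 1]`. -/
noncomputable def gegenbauerIntegral (a : ℝ) (p : ℝ[X]) : ℝ :=
  ∫ x in (-1 : ℝ)..1, p.eval x * (1 - x ^ 2) ^ (a - 1 / 2)

section
open Polynomial

variable {a : ℝ}

theorem gegenbauerIntegral_C_mul (c : ℝ) (p : ℝ[X]) :
    gegenbauerIntegral a (C c * p) = c * gegenbauerIntegral a p := by
  simp [gegenbauerIntegral, mul_assoc]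

theorem gegenbauerIntegral_add (ha : 0 < a) (p q : ℝ[X]) :
    gegenbauerIntegral a (p + q) = gegenbauerIntegral a p + gegenbauerIntegral a q := by
  simp only [gegenbauerIntegral, eval_add, add_mul]
  exact intervalIntegral.integral_add (intervalIntegrable_eval_mul_weight ha p)
    (intervalIntegrable_eval_mul_weight ha q)

theorem gegenbauerIntegral_sub (ha : 0 < a) (p q : ℝ[X]) :
    gegenbauerIntegral a (p - q) = gegenbauerIntegral a p - gegenbauerIntegral a q := by
  simp only [gegenbauerIntegral, eval_sub, sub_mul]
  exact intervalIntegral.integral_sub (intervalIntegrable_eval_mul_weight ha p)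
    (intervalIntegrable_eval_mul_weight ha q)

theorem gegenbauerIntegral_one_sub_X_sq_mul_derivative (ha : 0 < a) (q : ℝ[X]) :
    gegenbauerIntegral a ((1 - X ^ 2) * derivative q)
      = (2 * a + 1) * gegenbauerIntegral a (X * q) := by
  have key : gegenbauerIntegral a ((1 - X ^ 2) * derivative q - C (2 * a + 1) * (X * q)) = 0 := by
    unfold gegenbauerIntegral
    have h := intervalIntegral.integral_eq_sub_of_hasDerivAt_of_le
      (f := fun x : ℝ => q.eval x * (1 - x ^ 2) ^ (a + 1 / 2)) (a := -1) (b := 1)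
      (by norm_num) ?_ ?_
      (intervalIntegrable_eval_mul_weight ha
        ((1 - X ^ 2) * derivative q - C (2 * a + 1) * (X * q)))
    · rw [h]
      have : a + 1 / 2 ≠ 0 := by positivity
      simp only [one_pow, neg_sq, sub_self, zero_rpow this, mul_zero]
    · exact (q.continuous.mul
        ((by fun_prop : Continuous fun x : ℝ => 1 - x ^ 2).rpow_const
          fun x => Or.inr (by positivity))).continuousOn
    · intro x hx
      have hpos : 0 < 1 - x ^ 2 := by nlinarith [hx.1, hx.2]
      have hw : HasDerivAt (fun x : ℝ => 1 - x ^ 2) (-(2 * x)) x := by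
        simpa using (hasDerivAt_pow 2 x).const_sub 1
      refine ((q.hasDerivAt x).mul (hw.rpow_const (p := a + 1 / 2) (Or.inl hpos.ne'))).congr_deriv ?_
      rw [show a + 1 / 2 - 1 = a - 1 / 2 by ring, show a + 1 / 2 = (a - 1 / 2) + 1 by ring,
        rpow_add_one hpos.ne']
      simp only [eval_mul, eval_sub, eval_one, eval_pow, eval_C, eval_X]
      ring
  rw [gegenbauerIntegral_sub ha, gegenbauerIntegral_C_mul] at key
  linarith

theorem gegenbauerIntegral_gegenbauerPoly_add_two (ha : 0 < a) (n : ℕ) :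
    ((n : ℝ) + 2) * (n + 2 + 2 * a) * gegenbauerIntegral a (gegenbauerPoly a (n + 2))
      = n * (n + 2 * a) * gegenbauerIntegral a (gegenbauerPoly a n) := by
  have h1 := gegenbauerIntegral_one_sub_X_sq_mul_derivative ha (gegenbauerPoly a (n + 1))
  rw [one_sub_X_sq_mul_derivative_gegenbauerPoly] at h1
  have h2 := congrArg (gegenbauerIntegral a) (gegenbauerPoly_recurrence a n)
  simp only [gegenbauerIntegral_sub ha, gegenbauerIntegral_C_mul] at h1 h2
  linear_combination ((n : ℝ) + 2 + 2 * a) * h2 - 2 * (n + 1 + a) * h1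

theorem gegenbauerIntegral_gegenbauerPoly_succ (ha : 0 < a) :
    ∀ n, gegenbauerIntegral a (gegenbauerPoly a (n + 1)) = 0
  | 0 => by
      have h := gegenbauerIntegral_one_sub_X_sq_mul_derivative ha 1
      have hx : gegenbauerIntegral a (X * 1) = 0 := by
        have h0 : gegenbauerIntegral a ((1 - X ^ 2) * derivative (1 : ℝ[X])) = 0 := by
          simp [gegenbauerIntegral]
        rw [h0] at h
        have : 2 * a + 1 ≠ 0 := by positivity
        simpa [this] using h.symm
      rw [mul_one] at hx
      rw [zero_add, gegenbauerPoly, gegenbauerIntegral_C_mul, hx, mul_zero]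
  | 1 => by
      have h := gegenbauerIntegral_gegenbauerPoly_add_two ha 0
      have : (0 + 2) * (0 + 2 + 2 * a) ≠ 0 := by positivity
      simpa [ha.ne', this, (by positivity : 2 + 2 * a ≠ 0)] using h
  | n + 2 => by
      have h := gegenbauerIntegral_gegenbauerPoly_add_two ha (n + 1)
      rw [gegenbauerIntegral_gegenbauerPoly_succ ha n, mul_zero] at h
      exact (mul_eq_zero.1 h).resolve_left (by positivity)

theorem gegenbauerIntegral_mul_X_mul_gegenbauerPoly (ha : 0 < a) (p : ℝ[X]) (n : ℕ) :
    2 * ((n : ℝ) + 1 + a) * gegenbauerIntegral a (p * (X * gegenbauerPoly a (n + 1)))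
      = (n + 2) * gegenbauerIntegral a (p * gegenbauerPoly a (n + 2))
        + (n + 2 * a) * gegenbauerIntegral a (p * gegenbauerPoly a n) := by
  have h := congrArg (fun q => gegenbauerIntegral a (p * q)) (X_mul_gegenbauerPoly a n)
  simp only [mul_add, mul_left_comm p (C _), gegenbauerIntegral_add ha,
    gegenbauerIntegral_C_mul] at h
  simpa only [mul_add] using h

theorem gegenbauerIntegral_mul_of_lt (ha : 0 < a) :
    ∀ k m, k < m → gegenbauerIntegral a (gegenbauerPoly a k * gegenbauerPoly a m) = 0
  | 0, m, hm => by
      obtain ⟨m, rfl⟩ := Nat.exists_eq_add_of_lt hm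
      simpa [gegenbauerPoly] using gegenbauerIntegral_gegenbauerPoly_succ ha m
  | 1, m, hm => by
      obtain ⟨m, rfl⟩ := Nat.exists_eq_add_of_le hm
      have h := gegenbauerIntegral_mul_X_mul_gegenbauerPoly ha 1 (m + 1)
      simp only [one_mul, gegenbauerIntegral_gegenbauerPoly_succ ha, mul_zero, add_zero] at h
      rw [show Nat.succ 1 + m = m + 1 + 1 by omega, gegenbauerPoly, mul_assoc,
        gegenbauerIntegral_C_mul,
        (mul_eq_zero.1 h).resolve_left (by positivity), mul_zero]
  | k + 2, m, hm => by
      obtain ⟨m, rfl⟩ := Nat.exists_eq_add_of_le' (show 1 ≤ m by omega)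
      have h := gegenbauerIntegral_mul_X_mul_gegenbauerPoly ha (gegenbauerPoly a (k + 1)) m
      rw [gegenbauerIntegral_mul_of_lt ha (k + 1) (m + 2) (by omega),
        gegenbauerIntegral_mul_of_lt ha (k + 1) m (by omega), mul_zero, mul_zero, add_zero] at h
      have hx := (mul_eq_zero.1 h).resolve_left (by positivity)
      have hr := congrArg (fun q => gegenbauerIntegral a (q * gegenbauerPoly a (m + 1)))
        (gegenbauerPoly_recurrence a k)
      simp only [sub_mul, mul_assoc, gegenbauerIntegral_sub ha, gegenbauerIntegral_C_mul] at hr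
      rw [gegenbauerIntegral_mul_of_lt ha k (m + 1) (by omega), mul_left_comm X, hx, mul_zero,
        mul_zero, mul_zero, sub_zero] at hr
      exact (mul_eq_zero.1 hr).resolve_left (by positivity)

theorem gegenbauerIntegral_sq_succ (ha : 0 < a) (n : ℕ) :
    ((n : ℝ) + 1) * (n + 1 + a) * gegenbauerIntegral a (gegenbauerPoly a (n + 1) ^ 2)
      = (n + a) * (n + 2 * a) * gegenbauerIntegral a (gegenbauerPoly a n ^ 2) := by
  have h := gegenbauerIntegral_mul_X_mul_gegenbauerPoly ha (gegenbauerPoly a n) n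
  rw [gegenbauerIntegral_mul_of_lt ha n (n + 2) (by omega), mul_zero, zero_add, ← sq] at h
  have hr : ((n : ℝ) + 1) * gegenbauerIntegral a (gegenbauerPoly a (n + 1) ^ 2)
      = 2 * (n + a) *
        gegenbauerIntegral a (gegenbauerPoly a n * (X * gegenbauerPoly a (n + 1))) := by
    cases n with
    | zero =>
      simp only [gegenbauerPoly, one_mul, Nat.cast_zero, zero_add, sq, mul_assoc,
        gegenbauerIntegral_C_mul]
    | succ n =>
      have hr := congrArg (fun q => gegenbauerIntegral a (q * gegenbauerPoly a (n + 2)))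
        (gegenbauerPoly_recurrence a n)
      simp only [sub_mul, mul_assoc, gegenbauerIntegral_sub ha, gegenbauerIntegral_C_mul] at hr
      rw [gegenbauerIntegral_mul_of_lt ha n (n + 2) (by omega), mul_zero, sub_zero,
        mul_left_comm X] at hr
      push_cast
      rw [sq]
      linear_combination hr
  linear_combination (n + 1 + a) * hr + (n + a) * h

theorem gegenbauerIntegral_sq (ha : 0 < a) (n : ℕ) :
    ((n : ℝ) + a) * n.factorial * gegenbauerIntegral a (gegenbauerPoly a n ^ 2)
      = a * poch (2 * a) n * gegenbauerIntegral a 1 := by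
  induction n with
  | zero => simp [gegenbauerPoly, poch]
  | succ n ih =>
    rw [poch_succ, Nat.factorial_succ]
    push_cast
    linear_combination (n.factorial : ℝ) * gegenbauerIntegral_sq_succ ha n + (n + 2 * a) * ih

variable (a) in
/-- The quotient `(C_{2n}^{(a)} - C_{2n}^{(a)}(0)) / X`. -/
noncomputable def gegenbauerQuot : ℕ → ℝ[X]
  | 0 => 0
  | n + 1 =>
      C (2 * (n : ℝ) + 2)⁻¹ * (C (2 * (2 * (n : ℝ) + 1 + a)) * gegenbauerPoly a (2 * n + 1)
        - C (2 * (n : ℝ) + 2 * a) * gegenbauerQuot n)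

theorem gegenbauerQuot_recurrence (n : ℕ) :
    C (2 * (n : ℝ) + 2) * gegenbauerQuot a (n + 1)
      = C (2 * (2 * (n : ℝ) + 1 + a)) * gegenbauerPoly a (2 * n + 1)
        - C (2 * (n : ℝ) + 2 * a) * gegenbauerQuot a n := by
  rw [gegenbauerQuot, ← mul_assoc, ← C_mul, mul_inv_cancel₀ (by positivity), C_1, one_mul]

theorem mul_eval_gegenbauerQuot (x : ℝ) (n : ℕ) :
    x * (gegenbauerQuot a n).eval x = gegenbauerC a (2 * n) x - gegenbauerC a (2 * n) 0 := by
  induction n with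
  | zero => simp [gegenbauerQuot, gegenbauerC]
  | succ n ih =>
    simp only [← eval_gegenbauerPoly] at ih ⊢
    have h (y : ℝ) := congrArg (eval y) (gegenbauerPoly_recurrence a (2 * n))
    have hq := congrArg (eval x) (gegenbauerQuot_recurrence (a := a) n)
    push_cast at h
    simp only [eval_mul, eval_sub, eval_C, eval_X] at h hq
    apply mul_left_cancel₀ (show 2 * (n : ℝ) + 2 ≠ 0 by positivity)
    rw [Nat.mul_succ]
    linear_combination x * hq - h x + h 0 - (2 * (n : ℝ) + 2 * a) * ih

theorem gegenbauerIntegral_gegenbauerQuot_mul (ha : 0 < a) {n m : ℕ} (hm : 2 * n ≤ m) :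
    gegenbauerIntegral a (gegenbauerQuot a n * gegenbauerPoly a m) = 0 := by
  induction n with
  | zero => simp [gegenbauerQuot, gegenbauerIntegral]
  | succ n ih =>
    have h := congrArg (fun q => gegenbauerIntegral a (q * gegenbauerPoly a m))
      (gegenbauerQuot_recurrence (a := a) n)
    simp only [sub_mul, mul_assoc, gegenbauerIntegral_sub ha, gegenbauerIntegral_C_mul] at h
    rw [ih (by omega), gegenbauerIntegral_mul_of_lt ha _ _ (by omega), mul_zero, mul_zero,
      mul_zero, sub_zero] at h
    exact (mul_eq_zero.1 h).resolve_left (by positivity)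

theorem gegenbauerIntegral_gegenbauerQuot_sq_succ (ha : 0 < a) (n : ℕ) :
    ((n : ℝ) + 1) ^ 2 * gegenbauerIntegral a (gegenbauerQuot a (n + 1) ^ 2)
      = (2 * n + 1 + a) ^ 2 * gegenbauerIntegral a (gegenbauerPoly a (2 * n + 1) ^ 2)
        + (n + a) ^ 2 * gegenbauerIntegral a (gegenbauerQuot a n ^ 2) := by
  have h : C (((n : ℝ) + 1) ^ 2) * gegenbauerQuot a (n + 1) ^ 2
      = C ((2 * n + 1 + a) ^ 2) * gegenbauerPoly a (2 * n + 1) ^ 2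
        + C ((n + a) ^ 2) * gegenbauerQuot a n ^ 2
        - C (2 * (2 * n + 1 + a) * (n + a)) *
          (gegenbauerQuot a n * gegenbauerPoly a (2 * n + 1)) := by
    apply Polynomial.funext
    intro x
    have hq := congrArg (eval x) (gegenbauerQuot_recurrence (a := a) n)
    simp only [eval_mul, eval_sub, eval_add, eval_pow, eval_C] at hq ⊢
    have hq' : ((n : ℝ) + 1) * (gegenbauerQuot a (n + 1)).eval x
      = (2 * n + 1 + a) * (gegenbauerPoly a (2 * n + 1)).eval x
        - (n + a) * (gegenbauerQuot a n).eval x := by linear_combination hq / 2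
    rw [← mul_pow, hq']
    ring
  have h' := congrArg (gegenbauerIntegral a) h
  simpa only [gegenbauerIntegral_sub ha, gegenbauerIntegral_add ha, gegenbauerIntegral_C_mul,
    gegenbauerIntegral_gegenbauerQuot_mul ha (Nat.le_succ (2 * n)), mul_zero, sub_zero] using h'

end

theorem poch_two_mul (a : ℝ) (n : ℕ) :
    poch (2 * a) (2 * n) = 4 ^ n * poch a n * poch (a + 1 / 2) n := by
  induction n with
  | zero => simp [poch]
  | succ n ih =>
    rw [Nat.mul_succ, poch_succ, poch_succ, ih, poch_succ, poch_succ]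
    push_cast
    ring

theorem Gamma_add_natCast_eq_poch {a : ℝ} (ha : 0 < a) (n : ℕ) :
    Real.Gamma (a + n) = poch a n * Real.Gamma a := by
  induction n with
  | zero => simp [poch]
  | succ n ih =>
    rw [poch_succ, Nat.cast_succ, ← add_assoc, Real.Gamma_add_one (by positivity), ih]
    ring

theorem two_mul_Xpoly {n : ℕ} (hn : 1 ≤ n) (a : ℝ) :
    2 * Xpoly n a = 4 ^ n * poch (a + 1 / 2) n - n.centralBinom * poch a n := by
  obtain ⟨n, rfl⟩ := Nat.exists_eq_add_of_le' hn
  have hc : (n + 1).centralBinom = 2 * (2 * n + 1).choose n := by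
    rw [Nat.centralBinom_eq_two_mul_choose, show 2 * (n + 1) = 2 * n + 1 + 1 by ring,
      Nat.choose_succ_succ, Nat.choose_symm_half]
    ring
  rw [Xpoly, hc, show 2 * (n + 1) - 1 = 2 * n + 1 by omega, Nat.add_sub_cancel, pow_succ 2,
    pow_mul, pow_succ 4]
  push_cast
  ring

theorem factorial_mul_gegenbauerIntegral_gegenbauerQuot_sq {a : ℝ} (ha : 0 < a) (n : ℕ) :
    ((2 * n).factorial : ℝ) * gegenbauerIntegral a (gegenbauerQuot a n ^ 2)
      = 2 * a * gegenbauerIntegral a 1 * poch a n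
        * (4 ^ n * poch (a + 1 / 2) n - n.centralBinom * poch a n) := by
  induction n with
  | zero => simp [gegenbauerQuot, gegenbauerIntegral, poch]
  | succ n ih =>
    have hs := gegenbauerIntegral_gegenbauerQuot_sq_succ ha n
    have hh := gegenbauerIntegral_sq ha (2 * n + 1)
    have hc : ((n : ℝ) + 1) * (n + 1).centralBinom = 2 * (2 * n + 1) * n.centralBinom := by
      exact_mod_cast Nat.succ_mul_centralBinom_succ n
    rw [poch_succ, poch_two_mul] at hh
    rw [Nat.mul_succ, Nat.factorial_succ, Nat.factorial_succ, poch_succ, poch_succ, pow_succ (4 : ℝ)]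
    rw [Nat.factorial_succ] at hh
    push_cast at hh ⊢
    apply mul_left_cancel₀ (show (n : ℝ) + 1 ≠ 0 by positivity)
    linear_combination 2 * (2 * (n : ℝ) + 1) * (2 * n).factorial * hs
      + 2 * (2 * n + 1 + a) * hh
      + 2 * (2 * n + 1) * (n + a) ^ 2 * ih
      + 2 * a * gegenbauerIntegral a 1 * poch a n ^ 2 * (a + n) ^ 2 * hc

theorem integral_rpow_mul_one_sub_rpow {u : ℝ} (hu : 0 < u) :
    ∫ x in (0 : ℝ)..1, x ^ (u - 1) * (1 - x) ^ (u - 1)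
      = Real.Gamma u ^ 2 / Real.Gamma (2 * u) := by
  have h := Complex.betaIntegral_eq_Gamma_mul_div (u : ℂ) u (by simpa) (by simpa)
  have hb : Complex.betaIntegral (u : ℂ) u
      = ((∫ x in (0 : ℝ)..1, x ^ (u - 1) * (1 - x) ^ (u - 1) : ℝ) : ℂ) := by
    rw [Complex.betaIntegral, ← intervalIntegral.integral_ofReal]
    refine intervalIntegral.integral_congr fun x hx => ?_
    rw [Set.uIcc_of_le zero_le_one] at hx
    rw [Complex.ofReal_mul, Complex.ofReal_cpow hx.1, Complex.ofReal_cpow (by linarith [hx.2])]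
    push_cast
    rfl
  rw [hb, ← Complex.ofReal_add, Complex.Gamma_ofReal, Complex.Gamma_ofReal] at h
  rw [sq, two_mul]
  exact_mod_cast h

theorem gegenbauerIntegral_one {a : ℝ} (ha : 0 < a) :
    4 * a * gegenbauerIntegral a 1
      = π * Real.Gamma (2 * a) / ((2 : ℝ) ^ (2 * a - 3) * Real.Gamma a ^ 2) := by
  have hsub : gegenbauerIntegral a 1
      = 2 * 4 ^ (a - 1 / 2) * (Real.Gamma (a + 1 / 2) ^ 2 / Real.Gamma (2 * a + 1)) := by
    have hb := integral_rpow_mul_one_sub_rpow (u := a + 1 / 2) (by positivity)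
    rw [show 2 * (a + 1 / 2) = 2 * a + 1 by ring] at hb
    have h := intervalIntegral.integral_comp_mul_sub (a := 0) (b := 1)
      (fun x : ℝ => (1 - x ^ 2) ^ (a - 1 / 2)) (two_ne_zero' ℝ) 1
    norm_num at h
    have hI : gegenbauerIntegral a 1 = ∫ x in (-1 : ℝ)..1, (1 - x ^ 2) ^ (a - 1 / 2) := by
      simp [gegenbauerIntegral]
    have hJ : ∫ x in (0 : ℝ)..1, (1 - (2 * x - 1) ^ 2) ^ (a - 1 / 2)
        = 4 ^ (a - 1 / 2) *
          ∫ x in (0 : ℝ)..1, x ^ (a + 1 / 2 - 1) * (1 - x) ^ (a + 1 / 2 - 1) := by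
      rw [← intervalIntegral.integral_const_mul]
      refine intervalIntegral.integral_congr fun x hx => ?_
      rw [Set.uIcc_of_le zero_le_one] at hx
      rw [show a + 1 / 2 - 1 = a - 1 / 2 by ring, ← mul_rpow hx.1 (by linarith [hx.2]),
        ← mul_rpow (by norm_num) (mul_nonneg hx.1 (by linarith [hx.2]))]
      ring_nf
    rw [hI, mul_assoc, ← hb, ← hJ]
    linarith
  have hd := Real.Gamma_mul_Gamma_add_half a
  have hG := Real.Gamma_pos_of_pos ha
  have hG2 : 0 < Real.Gamma (2 * a) := Real.Gamma_pos_of_pos (by positivity)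
  have hhalf : Real.Gamma (a + 1 / 2) = Real.Gamma (2 * a) * 2 ^ (1 - 2 * a) * √π / Real.Gamma a := by
    rw [eq_div_iff hG.ne', mul_comm, hd]
  have h4 : (4 : ℝ) ^ (a - 1 / 2) = 2 ^ (2 * a) / 2 := by
    rw [show (4 : ℝ) = 2 ^ (2 : ℝ) by norm_num, ← rpow_mul (by norm_num),
      show 2 * (a - 1 / 2) = 2 * a - 1 by ring, rpow_sub_one (by norm_num)]
  have h1 : (2 : ℝ) ^ (1 - 2 * a) = 2 / 2 ^ (2 * a) := by
    rw [rpow_sub (by norm_num), rpow_one]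
  have h3 : (2 : ℝ) ^ (2 * a - 3) = 2 ^ (2 * a) / 8 := by
    rw [rpow_sub (by norm_num)]
    norm_num
  rw [hsub, hhalf, h4, h1, h3, Real.Gamma_add_one (by positivity)]
  have hpi : √π ^ 2 = π := sq_sqrt pi_pos.le
  field_simp
  rw [hpi]
  ring

theorem gegenGamma_two_mul (a : ℝ) (n : ℕ) :
    gegenGamma a (2 * n) = gegenbauerIntegral a (gegenbauerQuot a n ^ 2) := by
  refine intervalIntegral.integral_congr_ae ?_
  filter_upwards [Measure.ae_ne volume (0 : ℝ)] with x hx _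
  rw [← mul_eval_gegenbauerQuot, mul_div_cancel_left₀ _ hx, Polynomial.eval_pow]

theorem gegenbauer_gamma_even (a : ℝ) (ha : 0 < a) (n : ℕ) (hn : 1 ≤ n) :
    gegenGamma a (2 * n)
      = π * Real.Gamma (2 * a) * Real.Gamma (a + n)
          / ((2 : ℝ) ^ (2 * a - 3) * Real.Gamma (2 * n + 1) * Real.Gamma a ^ 3)
        * Xpoly n a := by
  have h := factorial_mul_gegenbauerIntegral_gegenbauerQuot_sq ha n
  rw [← two_mul_Xpoly hn, ← gegenGamma_two_mul] at h
  have hf : ((2 * n).factorial : ℝ) ≠ 0 := by positivity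
  have hG := Real.Gamma_pos_of_pos ha
  have hfac : Real.Gamma (2 * n + 1) = (2 * n).factorial := by
    exact_mod_cast Real.Gamma_nat_eq_factorial (2 * n)
  apply mul_left_cancel₀ hf
  calc _ = 4 * a * gegenbauerIntegral a 1 * poch a n * Xpoly n a := by rw [h]; ring
    _ = _ := by
      rw [gegenbauerIntegral_one ha, Gamma_add_natCast_eq_poch ha, hfac]
      field_simp
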